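/- arXiv:2011.00827 — 2 statements merged into one kernel-verified Lean document; each statement's English description precedes it below -/
import Mathlib

section
/- Let 0 < u ≤ 2^{−16} and set a = 1 + u. Define h : ℂ → ℂ by h(w) = (sinh(a²w) − sinh(w))/w − (a² − 1) − sin(w)/w for w ≠ 0 (extended analytically at w = 0 with value −1). Then there exists φ with 0 ≤ φ ≤ 2(cosh(π) − 1)·u such that, setting α = π/(1+φ), the zeros of h in the open disk {w : |w| < 6.2} are exactly w = α and w = −α, and both are simple zeros (h′(±α) ≠ 0). -/
/-!
STATEMENT 10: localization of the zeros of
`h(w) = (sinh(a²w) − sinh(w))/w − (a² − 1) − sin(w)/w` (with `a = 1 + u`,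
`h(0) = −1`) in the disk `|w| < 6.2`: for `0 < u ≤ 2⁻¹⁶` the zeros are
exactly `±α` with `α = π/(1+φ)`, `0 ≤ φ ≤ 2(cosh π − 1)u`, and they are
simple.
-/

open Real


/-- `w` times the function `h` of the main theorem, with `b = a²`. -/
noncomputable def scaledDenominator (b w : ℂ) : ℂ :=
  Complex.sinh (b * w) - Complex.sinh w - (b - 1) * w - Complex.sin w

lemma norm_cosh_le_cosh_re (z : ℂ) : ‖Complex.cosh z‖ ≤ Real.cosh z.re := by
  rw [Complex.cosh, Real.cosh_eq, norm_div, Complex.norm_ofNat]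
  gcongr
  refine (norm_add_le _ _).trans_eq ?_
  simp [Complex.norm_exp]

lemma norm_sinh_le_cosh_re (z : ℂ) : ‖Complex.sinh z‖ ≤ Real.cosh z.re := by
  rw [Complex.sinh, Real.cosh_eq, norm_div, Complex.norm_ofNat]
  gcongr
  refine (norm_sub_le _ _).trans_eq ?_
  simp [Complex.norm_exp]

lemma cosh_le_of_abs_le {x : ℝ} (hx : |x| ≤ 6.25) : Real.cosh x ≤ 260 := by
  have h1 : Real.cosh x ≤ Real.cosh 6.25 :=
    Real.cosh_le_cosh.2 (hx.trans (le_abs_self _))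
  have h2 : Real.exp 6.25 ≤ 519 := by
    have h3 : Real.exp 6.25 ^ 4 = Real.exp 1 ^ 25 := by
      rw [← Real.exp_nat_mul, ← Real.exp_nat_mul]; norm_num
    have h4 : Real.exp 1 ^ 25 ≤ (519 : ℝ) ^ 4 :=
      (pow_le_pow_left₀ (Real.exp_pos 1).le Real.exp_one_lt_d9.le 25).trans (by norm_num)
    exact le_of_pow_le_pow_left₀ (by norm_num) (by norm_num) (h3.trans_le h4)
  have h5 : Real.exp (-6.25) ≤ 1 := Real.exp_le_one_iff.2 (by norm_num)
  rw [Real.cosh_eq 6.25] at h1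
  linarith

lemma convex_abs_re_le (r : ℝ) : Convex ℝ {z : ℂ | |z.re| ≤ r} := by
  have : {z : ℂ | |z.re| ≤ r} = Complex.reCLM ⁻¹' Set.Icc (-r) r := by
    ext z; simp [abs_le]
  rw [this]
  exact (convex_Icc _ _).linear_preimage Complex.reCLM.toLinearMap

section Perturbation

variable {e : ℝ} {w : ℂ}

lemma abs_re_le_of_norm_le (hw : ‖w‖ ≤ 6.2) : |w.re| ≤ 6.25 :=
  (Complex.abs_re_le_norm w).trans (hw.trans (by norm_num))

lemma abs_re_mul_le (he : 0 ≤ e) (he' : e ≤ 3.06e-5) (hw : ‖w‖ ≤ 6.2) :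
    |((1 + (e : ℂ)) * w).re| ≤ 6.25 := by
  refine (Complex.abs_re_le_norm _).trans ?_
  have h1 : ‖1 + (e : ℂ)‖ = 1 + e := by
    rw [← Complex.ofReal_one, ← Complex.ofReal_add, Complex.norm_real, Real.norm_eq_abs,
      abs_of_nonneg (by linarith)]
  rw [norm_mul, h1]
  nlinarith [norm_nonneg w]

lemma norm_one_add_mul_sub (he : 0 ≤ e) : ‖(1 + (e : ℂ)) * w - w‖ = e * ‖w‖ := by
  rw [show (1 + (e : ℂ)) * w - w = e * w by ring, norm_mul, Complex.norm_real, Real.norm_eq_abs,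
    abs_of_nonneg he]

lemma norm_sinh_perturbation_le (he : 0 ≤ e) (he' : e ≤ 3.06e-5) (hw : ‖w‖ ≤ 6.2) :
    ‖Complex.sinh ((1 + e) * w) - Complex.sinh w - e * w‖ ≤ 0.05 := by
  have key := Convex.norm_image_sub_le_of_norm_hasDerivWithin_le
    (f := fun z => Complex.sinh z - z) (f' := fun z => Complex.cosh z - 1) (C := 261)
    (fun z _ => ((Complex.hasDerivAt_sinh z).sub (hasDerivAt_id z)).hasDerivWithinAt)
    (fun z (hz : |z.re| ≤ 6.25) => (norm_sub_le _ _).trans (by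
      have := (norm_cosh_le_cosh_re z).trans (cosh_le_of_abs_le hz)
      rw [norm_one]; linarith))
    (convex_abs_re_le 6.25) (abs_re_le_of_norm_le hw) (abs_re_mul_le he he' hw)
  rw [norm_one_add_mul_sub he] at key
  rw [show Complex.sinh ((1 + e) * w) - Complex.sinh w - e * w
    = Complex.sinh ((1 + e) * w) - (1 + e) * w - (Complex.sinh w - w) by ring]
  refine key.trans ?_
  nlinarith [norm_nonneg w]

lemma norm_cosh_perturbation_le (he : 0 ≤ e) (he' : e ≤ 3.06e-5) (hw : ‖w‖ ≤ 6.2) :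
    ‖(1 + e) * Complex.cosh ((1 + e) * w) - Complex.cosh w - e‖ ≤ 0.1 := by
  have key := Convex.norm_image_sub_le_of_norm_hasDerivWithin_le
    (f := Complex.cosh) (f' := Complex.sinh) (C := 260)
    (fun z _ => (Complex.hasDerivAt_cosh z).hasDerivWithinAt)
    (fun z (hz : |z.re| ≤ 6.25) => (norm_sinh_le_cosh_re z).trans (cosh_le_of_abs_le hz))
    (convex_abs_re_le 6.25) (abs_re_le_of_norm_le hw) (abs_re_mul_le he he' hw)
  rw [norm_one_add_mul_sub he] at key
  have h1 := (norm_cosh_le_cosh_re _).trans (cosh_le_of_abs_le (abs_re_mul_le he he' hw))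
  have h2 : ‖(e : ℂ)‖ = e := by rw [Complex.norm_real, Real.norm_eq_abs, abs_of_nonneg he]
  rw [show (1 + e) * Complex.cosh ((1 + e) * w) - Complex.cosh w - e
    = (Complex.cosh ((1 + e) * w) - Complex.cosh w) + e * Complex.cosh ((1 + e) * w) - e by ring]
  refine (norm_sub_le _ _).trans ?_
  have h3 := norm_add_le (Complex.cosh ((1 + e) * w) - Complex.cosh w)
    (e * Complex.cosh ((1 + e) * w))
  rw [norm_mul, h2] at h3
  rw [h2]
  nlinarith [norm_nonneg w, norm_nonneg (Complex.cosh ((1 + e) * w))]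

end Perturbation

lemma hasDerivAt_scaledDenominator (b w : ℂ) :
    HasDerivAt (scaledDenominator b)
      (b * Complex.cosh (b * w) - Complex.cosh w - (b - 1) - Complex.cos w) w := by
  have h1 : HasDerivAt (fun z : ℂ => b * z) b w := by simpa using (hasDerivAt_id w).const_mul b
  have h2 : HasDerivAt (fun z : ℂ => (b - 1) * z) (b - 1) w := by
    simpa using (hasDerivAt_id w).const_mul (b - 1)
  have := (((h1.csinh).sub (Complex.hasDerivAt_sinh w)).sub h2).sub (Complex.hasDerivAt_sin w)
  refine this.congr_deriv ?_
  ring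

lemma norm_cos_sub_cos_le {c : ℝ} (hc : Real.sin c = 0) {w : ℂ} (hw : ‖w - c‖ ≤ 1 / 4) :
    ‖Complex.cos w - Complex.cos c‖ ≤ 1 / 4 := by
  have h1 : Complex.cos w - Complex.cos c = Complex.cos c * (Complex.cos (w - c) - 1) := by
    have h2 : Complex.sin (c : ℂ) = 0 := by rw [← Complex.ofReal_sin, hc, Complex.ofReal_zero]
    have h3 := Complex.cos_add (w - c) c
    rw [sub_add_cancel, h2] at h3
    rw [h3]; ring
  have h4 : ‖Complex.cos (c : ℂ)‖ ≤ 1 := by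
    rw [← Complex.ofReal_cos, Complex.norm_real]; exact Real.abs_cos_le_one c
  have h5 : ‖Complex.cos (w - c) - 1‖ ≤ 1 / 4 := by
    have h6 := Complex.cos_bound (x := w - c) (by linarith)
    have h7 : ‖(w - c) ^ 2 / 2‖ = ‖w - c‖ ^ 2 / 2 := by simp
    have h8 := norm_sub_le (Complex.cos (w - c) - (1 - (w - c) ^ 2 / 2)) ((w - c) ^ 2 / 2)
    rw [h7, show Complex.cos (w - c) - (1 - (w - c) ^ 2 / 2) - (w - c) ^ 2 / 2
      = Complex.cos (w - c) - 1 by ring] at h8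
    have h9 : ‖w - c‖ ^ 2 ≤ (1 / 4) ^ 2 := by gcongr
    have h10 : ‖w - c‖ ^ 4 ≤ (1 / 4) ^ 4 := by gcongr
    norm_num at h9 h10
    linarith
  rw [h1, norm_mul]
  nlinarith [norm_nonneg (Complex.cos (w - c) - 1), norm_nonneg (Complex.cos (c : ℂ))]

section Injectivity

variable {e c : ℝ} {w : ℂ}

lemma norm_deriv_scaledDenominator_add_cos_le (he : 0 ≤ e) (he' : e ≤ 3.06e-5)
    (hc : Real.sin c = 0) (hc' : |c| ≤ π) (hw : ‖w - c‖ ≤ 1 / 4) :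
    ‖(1 + e) * Complex.cosh ((1 + e) * w) - Complex.cosh w - (1 + e - 1) - Complex.cos w
      + Complex.cos c‖ ≤ 1 / 2 := by
  have hw' : ‖w‖ ≤ 6.2 := by
    have h1 := norm_add_le (w - c) c
    rw [sub_add_cancel, Complex.norm_real, Real.norm_eq_abs] at h1
    linarith [Real.pi_lt_d2]
  have h2 := norm_cosh_perturbation_le he he' hw'
  have h3 := norm_cos_sub_cos_le hc hw
  have h4 := norm_sub_le ((1 + e) * Complex.cosh ((1 + e) * w) - Complex.cosh w - e)
    (Complex.cos w - Complex.cos c)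
  rw [show (1 + e) * Complex.cosh ((1 + e) * w) - Complex.cosh w - (1 + e - 1) - Complex.cos w
      + Complex.cos c = ((1 + e) * Complex.cosh ((1 + e) * w) - Complex.cosh w - e) -
    (Complex.cos w - Complex.cos c) by ring]
  linarith

lemma norm_cos_of_sin_eq_zero (hc : Real.sin c = 0) : ‖Complex.cos c‖ = 1 := by
  rw [← Complex.ofReal_cos, Complex.norm_real, Real.norm_eq_abs]
  rcases Real.sin_eq_zero_iff_cos_eq.1 hc with h | h <;> simp [h]

lemma deriv_scaledDenominator_ne_zero (he : 0 ≤ e) (he' : e ≤ 3.06e-5)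
    (hc : Real.sin c = 0) (hc' : |c| ≤ π) (hw : ‖w - c‖ ≤ 1 / 4) :
    (1 + e) * Complex.cosh ((1 + e) * w) - Complex.cosh w - (1 + e - 1) - Complex.cos w ≠ 0 := by
  intro h
  have := norm_deriv_scaledDenominator_add_cos_le he he' hc hc' hw
  rw [h, zero_add, norm_cos_of_sin_eq_zero hc] at this
  norm_num at this

lemma scaledDenominator_injOn (he : 0 ≤ e) (he' : e ≤ 3.06e-5)
    (hc : Real.sin c = 0) (hc' : |c| ≤ π) :
    Set.InjOn (scaledDenominator (1 + e)) {w : ℂ | ‖w - c‖ ≤ 1 / 4} := by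
  have hconv : Convex ℝ {w : ℂ | ‖w - c‖ ≤ 1 / 4} := by
    have : {w : ℂ | ‖w - c‖ ≤ 1 / 4} = Metric.closedBall (c : ℂ) (1 / 4) := by
      ext w; simp [dist_eq_norm]
    rw [this]; exact convex_closedBall _ _
  intro z hz w hw hzw
  have key := Convex.norm_image_sub_le_of_norm_hasDerivWithin_le
    (f := fun z => scaledDenominator (1 + e) z + Complex.cos c * z) (C := 1 / 2)
    (fun z _ => ((hasDerivAt_scaledDenominator (1 + e) z).add
      (by simpa using (hasDerivAt_id z).const_mul (Complex.cos c))).hasDerivWithinAt)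
    (fun z (hz : ‖z - c‖ ≤ 1 / 4) => norm_deriv_scaledDenominator_add_cos_le he he' hc hc' hz)
    hconv hz hw
  simp only [hzw] at key
  rw [add_sub_add_left_eq_sub, ← mul_sub, norm_mul, norm_cos_of_sin_eq_zero hc] at key
  have h0 : ‖w - z‖ = 0 := by linarith [norm_nonneg (w - z)]
  exact (sub_eq_zero.1 (norm_eq_zero.1 h0)).symm

end Injectivity

lemma two_div_pi_mul_abs_le_abs_sin {t : ℝ} (ht : |t| ≤ π / 2) : 2 / π * |t| ≤ |Real.sin t| := by
  have h := Real.mul_le_sin (abs_nonneg t) ht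
  rwa [← Real.abs_sin_eq_sin_abs_of_abs_le_pi (ht.trans (by linarith [Real.pi_pos]))] at h

lemma exists_abs_sub_le_of_abs_sin_le {x : ℝ} (hx : |x| < 6.2) (hs : |Real.sin x| ≤ 0.05) :
    ∃ c : ℝ, (c = 0 ∨ c = π ∨ c = -π) ∧ |x - c| ≤ 0.1 := by
  have hp1 := Real.pi_gt_d4
  have hp2 := Real.pi_lt_d4
  have hpi : 0.63 ≤ 2 / π := by rw [le_div_iff₀ Real.pi_pos]; linarith
  have close : ∀ t : ℝ, |t| ≤ π / 2 → |Real.sin t| ≤ 0.05 → |t| ≤ 0.08 := fun t ht h => by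
    have := two_div_pi_mul_abs_le_abs_sin ht
    nlinarith [abs_nonneg t]
  obtain ⟨hx1, hx2⟩ := abs_lt.1 hx
  by_cases h1 : |x| ≤ π / 2
  · exact ⟨0, by simp, by rw [sub_zero]; linarith [close x h1 hs]⟩
  by_cases h2 : |x - π| ≤ π / 2
  · exact ⟨π, by simp, by linarith [close _ h2 (by rwa [Real.sin_sub_pi, abs_neg])]⟩
  by_cases h3 : |x - -π| ≤ π / 2
  · exact ⟨-π, by simp, by
      linarith [close _ h3 (by rwa [sub_neg_eq_add, Real.sin_add_pi, abs_neg])]⟩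
  exfalso
  have far : ∀ t : ℝ, |t| ≤ π / 2 → 0.083 ≤ |t| → |Real.sin t| ≤ 0.05 → False :=
    fun t ht ht' h => by linarith [close t ht h]
  rw [abs_le, not_and_or] at h1 h2 h3
  rcases le_total 0 x with h0 | h0
  · have hx3 : 3 * π / 2 < x := by
      rcases h1 with h1 | h1 <;> rcases h2 with h2 | h2 <;> linarith
    refine far (x - 2 * π) (abs_le.2 ⟨by linarith, by linarith⟩) ?_
      (by rwa [Real.sin_sub_two_pi])
    rw [abs_of_neg (by linarith)]; linarith
  · have hx3 : x < -(3 * π / 2) := by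
      rcases h1 with h1 | h1 <;> rcases h3 with h3 | h3 <;> linarith
    refine far (x + 2 * π) (abs_le.2 ⟨by linarith, by linarith⟩) ?_
      (by rwa [Real.sin_add_two_pi])
    rw [abs_of_pos (by linarith)]; linarith

lemma exists_norm_sub_le_of_norm_sin_le {w : ℂ} (hw : ‖w‖ < 6.2)
    (hs : ‖Complex.sin w‖ ≤ 0.05) :
    ∃ c : ℝ, (c = 0 ∨ c = π ∨ c = -π) ∧ ‖w - c‖ ≤ 1 / 4 := by
  have hre : (Complex.sin w).re = Real.sin w.re * Real.cosh w.im := by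
    rw [Complex.sin_eq, ← Complex.ofReal_sin, ← Complex.ofReal_cos, ← Complex.ofReal_cosh,
      ← Complex.ofReal_sinh]
    simp [-Complex.ofReal_sin, -Complex.ofReal_cos, -Complex.ofReal_cosh, -Complex.ofReal_sinh]
  have him : (Complex.sin w).im = Real.cos w.re * Real.sinh w.im := by
    rw [Complex.sin_eq, ← Complex.ofReal_sin, ← Complex.ofReal_cos, ← Complex.ofReal_cosh,
      ← Complex.ofReal_sinh]
    simp [-Complex.ofReal_sin, -Complex.ofReal_cos, -Complex.ofReal_cosh, -Complex.ofReal_sinh]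
  have hsq : Real.sin w.re ^ 2 + Real.sinh w.im ^ 2 ≤ 0.05 ^ 2 := by
    have h1 : ‖Complex.sin w‖ ^ 2 = Real.sin w.re ^ 2 + Real.sinh w.im ^ 2 := by
      rw [Complex.sq_norm, Complex.normSq_apply, hre, him]
      linear_combination Real.sin w.re ^ 2 * Real.cosh_sq w.im
        + Real.sinh w.im ^ 2 * Real.sin_sq_add_cos_sq w.re
    rw [← h1]; gcongr
  have hsin : |Real.sin w.re| ≤ 0.05 :=
    abs_le_of_sq_le_sq (by nlinarith [sq_nonneg (Real.sinh w.im)]) (by norm_num)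
  have hsinh : |Real.sinh w.im| ≤ 0.05 :=
    abs_le_of_sq_le_sq (by nlinarith [sq_nonneg (Real.sin w.re)]) (by norm_num)
  have him' : |w.im| ≤ 0.05 := by
    rw [Real.abs_sinh] at hsinh
    exact (Real.self_le_sinh_iff.2 (abs_nonneg _)).trans hsinh
  obtain ⟨c, hc, hxc⟩ :=
    exists_abs_sub_le_of_abs_sin_le ((Complex.abs_re_le_norm w).trans_lt hw) hsin
  refine ⟨c, hc, (Complex.norm_le_abs_re_add_abs_im _).trans ?_⟩
  simp only [Complex.sub_re, Complex.ofReal_re, Complex.sub_im, Complex.ofReal_im, sub_zero]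
  linarith

lemma sinh_sub_sinh_le {x y : ℝ} (hx : 0 ≤ x) (hxy : x ≤ y) :
    Real.sinh y - Real.sinh x ≤ (y - x) * Real.cosh y := by
  rcases hxy.eq_or_lt with rfl | hlt
  · simp
  obtain ⟨t, ht, h⟩ := exists_hasDerivAt_eq_slope Real.sinh Real.cosh hlt
    Real.continuous_sinh.continuousOn (fun t _ => Real.hasDerivAt_sinh t)
  rw [eq_div_iff (by linarith)] at h
  rw [← h, mul_comm]
  have : Real.cosh t ≤ Real.cosh y := Real.cosh_le_cosh.2 (by
    rw [abs_of_nonneg (hx.trans ht.1.le), abs_of_nonneg (hx.trans hxy)]; exact ht.2.le)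
  nlinarith

lemma mul_sinh_le_cosh_sub_cosh {x y : ℝ} (hxy : x ≤ y) :
    (y - x) * Real.sinh x ≤ Real.cosh y - Real.cosh x := by
  rcases hxy.eq_or_lt with rfl | hlt
  · simp
  obtain ⟨t, ht, h⟩ := exists_hasDerivAt_eq_slope Real.cosh Real.sinh hlt
    Real.continuous_cosh.continuousOn (fun t _ => Real.hasDerivAt_cosh t)
  rw [eq_div_iff (by linarith)] at h
  rw [← h, mul_comm]
  have : Real.sinh x ≤ Real.sinh t := Real.sinh_le_sinh.2 ht.1.le
  nlinarith

lemma le_cosh_pi_sub_one : 3 ≤ Real.cosh π - 1 := by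
  have h := Real.quadratic_le_exp_of_nonneg Real.pi_pos.le
  rw [Real.cosh_eq]
  nlinarith [Real.exp_pos (-π), Real.pi_gt_three]

lemma cosh_pi_sub_one_le : Real.cosh π - 1 ≤ 12 := by
  have h1 : Real.cosh π ≤ Real.cosh 3.2 := Real.cosh_le_cosh.2 (by
    rw [abs_of_pos Real.pi_pos, abs_of_pos (by norm_num)]; linarith [Real.pi_lt_d2])
  have h2 : Real.exp 3.2 ≤ 25 := by
    have h3 : Real.exp 3.2 ^ 5 = Real.exp 1 ^ 16 := by
      rw [← Real.exp_nat_mul, ← Real.exp_nat_mul]; norm_num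
    have h4 : Real.exp 1 ^ 16 ≤ (25 : ℝ) ^ 5 :=
      (pow_le_pow_left₀ (Real.exp_pos 1).le Real.exp_one_lt_d9.le 16).trans (by norm_num)
    exact le_of_pow_le_pow_left₀ (by norm_num) (by norm_num) (h3.trans_le h4)
  have h5 : Real.exp (-3.2) ≤ 1 := Real.exp_le_one_iff.2 (by norm_num)
  rw [Real.cosh_eq 3.2] at h1
  linarith

lemma scaledDenominator_ofReal (b x : ℝ) : scaledDenominator b x =
    ((Real.sinh (b * x) - Real.sinh x - (b - 1) * x - Real.sin x : ℝ) : ℂ) := by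
  simp [scaledDenominator]

lemma scaledDenominator_neg (b w : ℂ) : scaledDenominator b (-w) = -scaledDenominator b w := by
  simp only [scaledDenominator, mul_neg, Complex.sinh_neg, Complex.sin_neg]; ring

lemma scaledDenominator_real_nonpos {u : ℝ} (hu : 0 < u) (hu' : u ≤ 1 / 65536) {x : ℝ}
    (hx : x = π / (1 + 2 * (Real.cosh π - 1) * u)) :
    Real.sinh ((1 + u) ^ 2 * x) - Real.sinh x - ((1 + u) ^ 2 - 1) * x - Real.sin x ≤ 0 := by
  set C := Real.cosh π - 1 with hC
  have hC1 : 3 ≤ C := le_cosh_pi_sub_one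
  have hC2 : C ≤ 12 := cosh_pi_sub_one_le
  have hp1 := Real.pi_gt_d2
  have hp2 := Real.pi_lt_d2
  have hCu : C * u ≤ 12 * u := by gcongr
  have hCu' : 3 * u ≤ C * u := by gcongr
  have hxeq : x * (1 + 2 * (C * u)) = π := by
    rw [hx]; field_simp
  have hx1 : 3 ≤ x := by
    by_contra! h
    nlinarith
  have hx2 : x ≤ 3.15 := by nlinarith
  have hy : π - x = x * (2 * (C * u)) := by linarith
  have hy0 : 0 < π - x := by rw [hy]; positivity
  have hy1 : π - x ≤ 76 * u := by rw [hy]; nlinarith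
  have hsin : (π - x) - (π - x) ^ 3 / 6 ≤ Real.sin x := by
    rw [← Real.sin_pi_sub x]; exact (Real.sin_gt_sub_cube hy0).le
  have hbx : π - (1 + u) ^ 2 * x ≥ 11 * u := by
    have : π - (1 + u) ^ 2 * x = x * (2 * (C * u) - 2 * u - u ^ 2) := by
      rw [← hxeq]; ring
    rw [this]
    nlinarith
  have hbx3 : 3 ≤ (1 + u) ^ 2 * x := by nlinarith
  have hdrop : 33 * u ≤ Real.cosh π - Real.cosh ((1 + u) ^ 2 * x) := by
    have h1 := mul_sinh_le_cosh_sub_cosh (x := (1 + u) ^ 2 * x) (y := π) (by linarith)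
    have h2 : 3 ≤ Real.sinh ((1 + u) ^ 2 * x) :=
      hbx3.trans (Real.self_le_sinh_iff.2 (by linarith))
    nlinarith
  have hsinh := sinh_sub_sinh_le (x := x) (y := (1 + u) ^ 2 * x) (by linarith) (by nlinarith)
  have hy2 : (π - x) ^ 2 ≤ u := by
    calc (π - x) ^ 2 ≤ (76 * u) ^ 2 := by gcongr
      _ ≤ u := by nlinarith
  have hcube : (π - x) ^ 3 / 6 ≤ x * (2 * u) * (2 * u) := by
    have h1 : (π - x) ^ 3 = (π - x) ^ 2 * (x * (2 * (C * u))) := by rw [← hy]; ring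
    have h2 : (π - x) ^ 2 * (x * (2 * (C * u))) ≤ u * (x * (2 * (12 * u))) := by gcongr
    rw [h1]
    linarith
  have hmain : (2 * u + u ^ 2) * (Real.cosh ((1 + u) ^ 2 * x) - 1) ≤ 2 * u * C - 2 * u * (2 * u) := by
    have h1 : Real.cosh ((1 + u) ^ 2 * x) - 1 ≤ C - 33 * u := by linarith
    have h2 : (2 * u + u ^ 2) * (Real.cosh ((1 + u) ^ 2 * x) - 1)
      ≤ (2 * u + u ^ 2) * (C - 33 * u) := by gcongr
    nlinarith [mul_pos hu hu, mul_pos (mul_pos hu hu) hu]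
  have hmul := mul_le_mul_of_nonneg_left hmain (by linarith : 0 ≤ x)
  nlinarith

lemma scaledDenominator_real_pi_nonneg {u : ℝ} (hu : 0 < u) :
    0 ≤ Real.sinh ((1 + u) ^ 2 * π) - Real.sinh π - ((1 + u) ^ 2 - 1) * π - Real.sin π := by
  have hpi := Real.pi_pos
  rw [Real.sin_pi, sub_zero]
  have hle : π ≤ (1 + u) ^ 2 * π := by nlinarith [mul_pos hu hpi]
  have hmono := Real.sinh_sub_id_strictMono.monotone hle
  linarith

lemma exists_real_root {u : ℝ} (hu : 0 < u) (hu' : u ≤ 1 / 65536) :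
    ∃ φ : ℝ, 0 ≤ φ ∧ φ ≤ 2 * (Real.cosh π - 1) * u ∧
      scaledDenominator (1 + ((2 * u + u ^ 2 : ℝ) : ℂ)) ((π / (1 + φ) : ℝ) : ℂ) = 0 := by
  have hC := le_cosh_pi_sub_one
  have hpi := Real.pi_pos
  have hφ : 0 ≤ 2 * (Real.cosh π - 1) * u := by positivity
  have hcont : ContinuousOn (fun φ : ℝ => Real.sinh ((1 + u) ^ 2 * (π / (1 + φ)))
      - Real.sinh (π / (1 + φ)) - ((1 + u) ^ 2 - 1) * (π / (1 + φ)) - Real.sin (π / (1 + φ)))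
      (Set.Icc 0 (2 * (Real.cosh π - 1) * u)) := by
    have hq : ContinuousOn (fun φ : ℝ => π / (1 + φ)) (Set.Icc 0 (2 * (Real.cosh π - 1) * u)) :=
      continuousOn_const.div (by fun_prop) (fun φ h => by linarith [h.1])
    have hf : Continuous (fun x : ℝ => Real.sinh ((1 + u) ^ 2 * x) - Real.sinh x
        - ((1 + u) ^ 2 - 1) * x - Real.sin x) := by fun_prop
    exact hf.comp_continuousOn hq
  obtain ⟨φ, hmem, h0⟩ := intermediate_value_Icc' hφ hcont
    (show (0 : ℝ) ∈ _ from ⟨scaledDenominator_real_nonpos hu hu' rfl,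
      by simpa using scaledDenominator_real_pi_nonneg hu⟩)
  refine ⟨φ, hmem.1, hmem.2, ?_⟩
  rw [← Complex.ofReal_one, ← Complex.ofReal_add, scaledDenominator_ofReal,
    show 1 + (2 * u + u ^ 2) = (1 + u) ^ 2 by ring]
  exact_mod_cast h0

lemma norm_pi_div_sub_pi_le {φ : ℝ} (h0 : 0 ≤ φ) (h1 : φ ≤ 1 / 20) : |π / (1 + φ) - π| ≤ 1 / 4 := by
  have hpi := Real.pi_pos
  have hlt := Real.pi_lt_d2
  have h : π / (1 + φ) - π = -(π * φ / (1 + φ)) := by field_simp; ring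
  rw [h, abs_neg, abs_of_nonneg (by positivity), div_le_iff₀ (by linarith)]
  nlinarith

lemma eq_of_scaledDenominator_eq_zero {e α : ℝ} (he : 0 ≤ e) (he' : e ≤ 3.06e-5)
    (hα : |α - π| ≤ 1 / 4) (hroot : scaledDenominator (1 + e) α = 0) {w : ℂ} (hw : ‖w‖ < 6.2)
    (h : scaledDenominator (1 + e) w = 0) : w = 0 ∨ w = α ∨ w = -α := by
  have hs : ‖Complex.sin w‖ ≤ 0.05 := by
    have h1 : Complex.sin w = Complex.sinh ((1 + e) * w) - Complex.sinh w - e * w := by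
      unfold scaledDenominator at h
      linear_combination -h
    rw [h1]; exact norm_sinh_perturbation_le he he' hw.le
  have hπ : |π| ≤ π := (abs_of_pos Real.pi_pos).le
  have hα' : ‖(α : ℂ) - π‖ ≤ 1 / 4 := by
    rw [← Complex.ofReal_sub, Complex.norm_real]; exact hα
  obtain ⟨c, rfl | rfl | rfl, hwc⟩ := exists_norm_sub_le_of_norm_sin_le hw hs
  · refine Or.inl (scaledDenominator_injOn he he' Real.sin_zero (by simpa using Real.pi_pos.le)
      hwc (by simp) ?_)
    rw [h]; simp [scaledDenominator]
  · exact Or.inr (Or.inl (scaledDenominator_injOn he he' Real.sin_pi hπ hwc hα'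
      (h.trans hroot.symm)))
  · refine Or.inr (Or.inr (scaledDenominator_injOn he he' (by simp) (by rwa [abs_neg])
      hwc ?_ ?_))
    · rw [Set.mem_ofPred_eq, Complex.ofReal_neg, ← norm_neg]
      simpa [sub_eq_add_neg, add_comm] using hα'
    · rw [h, scaledDenominator_neg, hroot, neg_zero]

lemma deriv_ne_zero_of_eq_div {F h : ℂ → ℂ} {F' z : ℂ} (hF : HasDerivAt F F' z) (hF' : F' ≠ 0)
    (hz : z ≠ 0) (h0 : F z = 0) (hh : ∀ w ≠ 0, h w = F w / w) : deriv h z ≠ 0 := by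
  have heq : h =ᶠ[nhds z] fun w => F w / w := by
    filter_upwards [isOpen_ne.mem_nhds hz] with w hw using hh w hw
  have hd : HasDerivAt (fun w => F w / w) ((F' * z - F z * 1) / z ^ 2) z :=
    hF.div (hasDerivAt_id z) hz
  rw [heq.deriv_eq, hd.deriv, h0, zero_mul, sub_zero]
  exact div_ne_zero (mul_ne_zero hF' hz) (pow_ne_zero 2 hz)

theorem bernoulli_denominator_dominant_root
    (u : ℝ) (hu : 0 < u) (hu' : u ≤ (2 : ℝ) ^ (-16 : ℤ)) :
    ∃ φ : ℝ, 0 ≤ φ ∧ φ ≤ 2 * (Real.cosh Real.pi - 1) * u ∧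
      (let a : ℂ := 1 + (u : ℂ)
       let h : ℂ → ℂ := fun w =>
         if w = 0 then -1 else
           (Complex.sinh (a ^ 2 * w) - Complex.sinh w) / w - (a ^ 2 - 1)
             - Complex.sin w / w
       let α : ℝ := Real.pi / (1 + φ)
       (∀ w : ℂ, ‖w‖ < 6.2 → (h w = 0 ↔ w = (α : ℂ) ∨ w = -(α : ℂ))) ∧
       deriv h (α : ℂ) ≠ 0 ∧ deriv h (-(α : ℂ)) ≠ 0) := by
  have hu1 : u ≤ 1 / 65536 := hu'.trans (by norm_num)
  obtain ⟨φ, hφ0, hφ1, hroot⟩ := exists_real_root hu hu1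
  refine ⟨φ, hφ0, hφ1, ?_⟩
  intro a h α
  set e : ℝ := 2 * u + u ^ 2 with he_def
  have he : 0 ≤ e := by positivity
  have he' : e ≤ 3.06e-5 := by rw [he_def]; nlinarith
  have ha : a ^ 2 = 1 + (e : ℂ) := by simp only [a, he_def]; push_cast; ring
  have hα : |α - π| ≤ 1 / 4 :=
    norm_pi_div_sub_pi_le hφ0 (hφ1.trans (by nlinarith [cosh_pi_sub_one_le]))
  have hα0 : (α : ℂ) ≠ 0 := by
    have : 0 < α := by have := Real.pi_pos; positivity
    exact_mod_cast this.ne'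
  have hh : ∀ w ≠ 0, h w = scaledDenominator (1 + e) w / w := fun w hw => by
    simp only [h, if_neg hw, scaledDenominator, ha]
    field_simp
  have hroot' : scaledDenominator (1 + e) (-α) = 0 := by
    rw [scaledDenominator_neg, hroot, neg_zero]
  have hα' : ‖(α : ℂ) - π‖ ≤ 1 / 4 := by
    rw [← Complex.ofReal_sub, Complex.norm_real]; exact hα
  have hα'' : ‖-(α : ℂ) - ((-π : ℝ) : ℂ)‖ ≤ 1 / 4 := by
    rw [Complex.ofReal_neg, ← norm_neg]; simpa [sub_eq_add_neg, add_comm] using hα'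
  have hπ : |π| ≤ π := (abs_of_pos Real.pi_pos).le
  refine ⟨fun w hw => ⟨fun hw0 => ?_, ?_⟩, ?_, ?_⟩
  · by_cases hne : w = 0
    · simp [h, hne] at hw0
    rw [hh w hne, div_eq_zero_iff, or_iff_left hne] at hw0
    exact (eq_of_scaledDenominator_eq_zero he he' hα hroot hw hw0).resolve_left hne
  · rintro (rfl | rfl)
    · rw [hh _ hα0, hroot, zero_div]
    · rw [hh _ (neg_ne_zero.2 hα0), hroot', zero_div]
  · exact deriv_ne_zero_of_eq_div (hasDerivAt_scaledDenominator _ _)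
      (deriv_scaledDenominator_ne_zero he he' Real.sin_pi hπ hα') hα0 hroot hh
  · exact deriv_ne_zero_of_eq_div (hasDerivAt_scaledDenominator _ _)
      (deriv_scaledDenominator_ne_zero he he' (by simp) (by rwa [abs_neg]) hα'')
      (neg_ne_zero.2 hα0) hroot' hh
end

section
/- Let n ≥ 1 and 0 < a ≤ 1. Let (Δ_i^k) and (δ_i^k), for i ∈ ℤ and k ∈ ℕ, be real doubly-indexed sequences that are 2n-periodic in i, satisfying Δ_i^0 = δ_i^0, Δ_i^1 = δ_i^1, and Δ_i^{k+1} = 2Δ_i^k − Δ_i^{k−1} + a(Δ_{i+1}^k − 2Δ_i^k + Δ_{i−1}^k) + δ_i^{k+1} for all i and all k ≥ 1. Assume there are constants δ̄⁰, δ̄¹, δ̄ ≥ 0 with δ̄⁰ ≤ δ̄ and δ̄¹ + 2δ̄⁰ ≤ δ̄ such that |δ_i^0| ≤ δ̄⁰, |δ_i^1| ≤ δ̄¹, and |δ_i^k| ≤ δ̄ for all i and all k ≥ 2. Then |Δ_i^k| ≤ (k+1)(k+2)·δ̄/2 for all i and k. -/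
open Polynomial Finset

section BinaryForm

variable {R S : Type*} [CommRing R] [CommRing S]

/-- The dehomogenization `(p X + q) ^ m (r X + t) ^ n` of the image of the monomial `x ^ m y ^ n`
under the linear substitution with matrix `!![p, q; r, t]`. -/
noncomputable def binaryForm (p q r t : R) (m n : ℕ) : R[X] :=
  (C p * X + C q) ^ m * (C r * X + C t) ^ n

/-- The diagonal entry, at the monomial `x ^ m y ^ n`, of the symmetric power of
`!![p, q; r, t]`. -/
noncomputable def diagCoeff (p q r t : R) (m n : ℕ) : R :=
  (binaryForm p q r t m n).coeff m

lemma map_binaryForm (f : R →+* S) (p q r t : R) (m n : ℕ) :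
    (binaryForm p q r t m n).map f = binaryForm (f p) (f q) (f r) (f t) m n := by
  simp [binaryForm]

lemma map_diagCoeff (f : R →+* S) (p q r t : R) (m n : ℕ) :
    f (diagCoeff p q r t m n) = diagCoeff (f p) (f q) (f r) (f t) m n := by
  rw [diagCoeff, diagCoeff, ← map_binaryForm, coeff_map]

lemma coeff_succ_linear_mul (p q : R) (P : R[X]) (m : ℕ) :
    ((C p * X + C q) * P).coeff (m + 1) = p * P.coeff m + q * P.coeff (m + 1) := by
  rw [add_mul, mul_assoc, coeff_add, coeff_C_mul, coeff_X_mul, coeff_C_mul]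

lemma binaryForm_succ_left (p q r t : R) (m n : ℕ) :
    binaryForm p q r t (m + 1) n = (C p * X + C q) * binaryForm p q r t m n := by
  simp only [binaryForm]; ring

lemma binaryForm_succ_right (p q r t : R) (m n : ℕ) :
    binaryForm p q r t m (n + 1) = (C r * X + C t) * binaryForm p q r t m n := by
  simp only [binaryForm]; ring

lemma diagCoeff_zero_left (p q r t : R) (n : ℕ) : diagCoeff p q r t 0 n = t ^ n := by
  simp [diagCoeff, binaryForm, coeff_zero_eq_eval_zero]

lemma natDegree_binaryForm_le (p q r t : R) (m n : ℕ) :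
    (binaryForm p q r t m n).natDegree ≤ m + n := by
  refine natDegree_mul_le.trans (add_le_add ?_ ?_)
  · simpa using natDegree_pow_le_of_le m (natDegree_linear_le (a := p) (b := q))
  · simpa using natDegree_pow_le_of_le n (natDegree_linear_le (a := r) (b := t))

lemma diagCoeff_succ_zero (p q r t : R) (m : ℕ) :
    diagCoeff p q r t (m + 1) 0 = p * diagCoeff p q r t m 0 := by
  have h : (binaryForm p q r t m 0).coeff (m + 1) = 0 :=
    coeff_eq_zero_of_natDegree_lt (Nat.lt_succ_of_le (natDegree_binaryForm_le p q r t m 0))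
  rw [diagCoeff, binaryForm_succ_left, coeff_succ_linear_mul, h, mul_zero, add_zero, diagCoeff]

lemma diagCoeff_succ_succ (p q r t : R) (m n : ℕ) :
    diagCoeff p q r t (m + 1) (n + 1) = p * diagCoeff p q r t m (n + 1)
      + t * diagCoeff p q r t (m + 1) n - (p * t - q * r) * diagCoeff p q r t m n := by
  simp only [diagCoeff]
  rw [binaryForm_succ_left p q r t m (n + 1), binaryForm_succ_left p q r t m n,
    coeff_succ_linear_mul, coeff_succ_linear_mul, binaryForm_succ_right, coeff_succ_linear_mul]
  ring

/-- The value of the homogenization of `P`, of total degree `k`, at `(u, v)`. -/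
noncomputable def evalHomogeneous (f : R →+* S) (k : ℕ) (P : R[X]) (u v : S) : S :=
  ∑ ij ∈ antidiagonal k, f (P.coeff ij.1) * u ^ ij.1 * v ^ ij.2

lemma evalHomogeneous_linear_mul (f : R →+* S) {k : ℕ} {P : R[X]} (hP : P.natDegree ≤ k)
    (u v : S) (p q : R) :
    evalHomogeneous f (k + 1) ((C p * X + C q) * P) u v
      = (f p * u + f q * v) * evalHomogeneous f k P u v := by
  have hX : ∑ ij ∈ antidiagonal (k + 1), f ((X * P).coeff ij.1) * u ^ ij.1 * v ^ ij.2
      = u * evalHomogeneous f k P u v := by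
    rw [Nat.sum_antidiagonal_succ, evalHomogeneous, mul_sum]
    simp only [mul_coeff_zero, coeff_X_zero, zero_mul, map_zero, zero_add, coeff_X_mul]
    exact sum_congr rfl fun _ _ => by ring
  have h1 : ∑ ij ∈ antidiagonal (k + 1), f (P.coeff ij.1) * u ^ ij.1 * v ^ ij.2
      = v * evalHomogeneous f k P u v := by
    rw [Nat.sum_antidiagonal_succ', evalHomogeneous, mul_sum,
      coeff_eq_zero_of_natDegree_lt (Nat.lt_succ_of_le hP)]
    simp only [map_zero, zero_mul, zero_add]
    exact sum_congr rfl fun _ _ => by ring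
  rw [add_mul (f p * u), mul_assoc (f p), mul_assoc (f q), ← hX, ← h1, mul_sum, mul_sum,
    ← sum_add_distrib, evalHomogeneous]
  refine sum_congr rfl fun ij _ => ?_
  rw [add_mul, mul_assoc (C p), coeff_add, coeff_C_mul, coeff_C_mul, map_add, map_mul, map_mul]
  ring

lemma evalHomogeneous_binaryForm (f : R →+* S) (p q r t : R) (m n : ℕ) (u v : S) :
    evalHomogeneous f (m + n) (binaryForm p q r t m n) u v
      = (f p * u + f q * v) ^ m * (f r * u + f t * v) ^ n := by
  induction m with
  | zero =>
    induction n with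
    | zero => simp [evalHomogeneous, binaryForm]
    | succ n ih =>
      rw [binaryForm_succ_right, ← add_assoc,
        evalHomogeneous_linear_mul f (natDegree_binaryForm_le p q r t 0 n), ih]
      ring
  | succ m ih =>
    rw [binaryForm_succ_left, Nat.add_right_comm,
      evalHomogeneous_linear_mul f (natDegree_binaryForm_le p q r t m n), ih]
    ring

lemma sum_antidiagonal_recurrence (F : ℕ → ℕ → R) (P T D : R)
    (hl : ∀ n, F 0 (n + 1) = T * F 0 n) (hr : ∀ m, F (m + 1) 0 = P * F m 0)
    (hs : ∀ m n, F (m + 1) (n + 1) = P * F m (n + 1) + T * F (m + 1) n - D * F m n) (k : ℕ) :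
    ∑ ij ∈ antidiagonal (k + 2), F ij.1 ij.2
      = (P + T) * ∑ ij ∈ antidiagonal (k + 1), F ij.1 ij.2
        - D * ∑ ij ∈ antidiagonal k, F ij.1 ij.2 := by
  have h1 : ∑ ij ∈ antidiagonal (k + 1), F ij.1 ij.2
      = F 0 (k + 1) + ∑ ij ∈ antidiagonal k, F (ij.1 + 1) ij.2 := Nat.sum_antidiagonal_succ
  have h2 : ∑ ij ∈ antidiagonal (k + 1), F ij.1 ij.2
      = F (k + 1) 0 + ∑ ij ∈ antidiagonal k, F ij.1 (ij.2 + 1) := Nat.sum_antidiagonal_succ'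
  rw [Nat.sum_antidiagonal_succ, Nat.sum_antidiagonal_succ']
  simp only [hl, hr, hs, sum_add_distrib, sum_sub_distrib, ← mul_sum]
  rw [hl] at h1
  rw [hr] at h2
  linear_combination -P * h2 - T * h1

end BinaryForm

section Rotation

/-- Duality for the symmetric powers of a rotation and of its transpose. -/
lemma choose_mul_coeff_binaryForm_rotation (c s : ℝ) {m n i j : ℕ} (h : i + j = m + n) :
    ((m + n).choose m : ℝ) * (binaryForm c (-s) s c m n).coeff i
      = ((i + j).choose i : ℝ) * (binaryForm c s (-s) c i j).coeff m := by
  have key : C ((m + n).choose m : ℝ) * binaryForm c (-s) s c m n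
      = ∑ ij ∈ antidiagonal (m + n),
        C (((m + n).choose ij.1 : ℝ) * (binaryForm c s (-s) c ij.1 ij.2).coeff m) * X ^ ij.1 := by
    refine Polynomial.funext fun v => ?_
    have hpoly : (C (c * v - s) * X + C (s * v + c)) ^ (m + n)
        = (C v * (C c * X + C s) + (C (-s) * X + C c)) ^ (m + n) := by
      simp only [map_add, map_sub, map_mul, map_neg]; ring
    rw [(Commute.all _ _).add_pow', (Commute.all _ _).add_pow'] at hpoly
    have hm := congrArg (fun P => P.coeff m) hpoly
    simp only [finsetSum_coeff, coeff_smul] at hm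
    simp only [nsmul_eq_mul] at hm
    rw [sum_eq_single (m, n)] at hm
    · rw [eval_finsetSum]
      have hl : ((C (c * v - s) * X) ^ m * (C (s * v + c)) ^ n).coeff m
          = (c * v - s) ^ m * (s * v + c) ^ n := by
        rw [mul_pow, mul_right_comm, ← C_pow, ← C_pow, ← C_mul, coeff_C_mul_X_pow, if_pos rfl]
      rw [hl] at hm
      simp only [binaryForm, eval_mul, eval_pow, eval_add, eval_C, eval_X]
      rw [show c * v + -s = c * v - s by ring, hm]
      refine sum_congr rfl fun ij _ => ?_
      rw [mul_pow, mul_assoc, ← C_pow, coeff_C_mul]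
      ring
    · rintro ⟨i, j⟩ hij hne
      have him : m ≠ i := by
        rintro rfl
        exact hne (Prod.ext rfl (Nat.add_left_cancel (mem_antidiagonal.1 hij)))
      rw [mul_pow, mul_right_comm, ← C_pow, ← C_pow, ← C_mul, coeff_C_mul_X_pow, if_neg him,
        mul_zero]
    · intro hmem
      exact (hmem (mem_antidiagonal.2 rfl)).elim
  have hi := congrArg (fun P => P.coeff i) key
  simp only [finsetSum_coeff, coeff_C_mul, coeff_X_pow, mul_ite, mul_one, mul_zero] at hi
  rw [hi, sum_eq_single (i, j), if_pos rfl, h]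
  · rintro ⟨i', j'⟩ hij hne
    refine if_neg ?_
    rintro rfl
    exact hne (Prod.ext rfl (Nat.add_left_cancel ((mem_antidiagonal.1 hij).trans h.symm)))
  · intro hmem
    exact (hmem (mem_antidiagonal.2 h)).elim

lemma coeff_binaryForm_rotation_mul_nonneg (c s : ℝ) {m n i j : ℕ} (h : i + j = m + n) :
    0 ≤ (binaryForm c (-s) s c m n).coeff i * (binaryForm c s (-s) c i j).coeff m := by
  have hdual := choose_mul_coeff_binaryForm_rotation c s h
  have h1 : (0 : ℝ) < (m + n).choose m := by exact_mod_cast Nat.choose_pos (Nat.le_add_right m n)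
  have h2 : (0 : ℝ) < (i + j).choose i := by exact_mod_cast Nat.choose_pos (Nat.le_add_right i j)
  refine nonneg_of_mul_nonneg_right (a := ((m + n).choose m : ℝ)) ?_ h1
  rw [← mul_assoc, hdual, mul_assoc]
  exact mul_nonneg h2.le (mul_self_nonneg _)

/-- The diagonal entries of the symmetric powers of `ρ * diag(X, 1) * ρᵀ`, where `ρ` is the
rotation `!![c, -s; s, c]`. -/
noncomputable def rotationDiag (c s : ℝ) (m n : ℕ) : ℝ[X] :=
  diagCoeff (C (c ^ 2) * X + C (s ^ 2)) (C (c * s) * (X - 1)) (C (c * s) * (X - 1))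
    (C (s ^ 2) * X + C (c ^ 2)) m n

lemma rotationDiag_eq_sum (c s : ℝ) (m n : ℕ) :
    rotationDiag c s m n = ∑ ij ∈ antidiagonal (m + n),
      C ((binaryForm c (-s) s c m n).coeff ij.1 * (binaryForm c s (-s) c ij.1 ij.2).coeff m)
        * X ^ ij.1 := by
  have h := evalHomogeneous_binaryForm ((C : ℝ[X] →+* ℝ[X][X]).comp C) c (-s) s c m n
    (C X * (C (C c) * X + C (C s))) (C (C (-s)) * X + C (C c))
  have hform : binaryForm (C (c ^ 2) * X + C (s ^ 2)) (C (c * s) * (X - 1)) (C (c * s) * (X - 1))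
      (C (s ^ 2) * X + C (c ^ 2)) m n
      = evalHomogeneous ((C : ℝ[X] →+* ℝ[X][X]).comp C) (m + n) (binaryForm c (-s) s c m n)
        (C X * (C (C c) * X + C (C s))) (C (C (-s)) * X + C (C c)) := by
    rw [h, binaryForm]
    refine congrArg₂ (fun P Q => P ^ m * Q ^ n) ?_ ?_ <;>
    · simp only [RingHom.comp_apply, map_add, map_sub, map_mul, map_neg, map_pow, map_one]
      ring
  rw [rotationDiag, diagCoeff, hform, evalHomogeneous, finsetSum_coeff]
  refine sum_congr rfl fun ij _ => ?_
  have hB := map_binaryForm (C : ℝ →+* ℝ[X]) c s (-s) c ij.1 ij.2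
  rw [RingHom.comp_apply, mul_pow, mul_assoc, mul_assoc, ← C_pow, coeff_C_mul, coeff_C_mul]
  change _ * (_ * (binaryForm (C c) (C s) (C (-s)) (C c) ij.1 ij.2).coeff m) = _
  rw [← hB, coeff_map, C_mul]
  ring

lemma coeff_rotationDiag_nonneg (c s : ℝ) (m n l : ℕ) : 0 ≤ (rotationDiag c s m n).coeff l := by
  rw [rotationDiag_eq_sum, finsetSum_coeff]
  refine sum_nonneg fun ij hij => ?_
  rw [coeff_C_mul_X_pow]
  split_ifs
  · exact coeff_binaryForm_rotation_mul_nonneg c s (mem_antidiagonal.1 hij)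
  · exact le_rfl

lemma eval_one_rotationDiag {c s : ℝ} (h : c ^ 2 + s ^ 2 = 1) (m n : ℕ) :
    (rotationDiag c s m n).eval 1 = 1 := by
  rw [rotationDiag, ← coe_evalRingHom, map_diagCoeff]
  simp [diagCoeff, binaryForm, h, add_comm (s ^ 2)]

/-- The trace of the symmetric power of `ρ * diag(X, 1) * ρᵀ * diag(1, X)`. -/
noncomputable def rotationTrace (c s : ℝ) (k : ℕ) : ℝ[X] :=
  ∑ ij ∈ antidiagonal k, X ^ ij.2 * rotationDiag c s ij.1 ij.2

lemma coeff_rotationTrace_nonneg (c s : ℝ) (k l : ℕ) : 0 ≤ (rotationTrace c s k).coeff l := by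
  rw [rotationTrace, finsetSum_coeff]
  refine sum_nonneg fun ij _ => ?_
  rw [coeff_X_pow_mul']
  split_ifs
  · exact coeff_rotationDiag_nonneg _ _ _ _ _
  · exact le_rfl

lemma eval_one_rotationTrace {c s : ℝ} (h : c ^ 2 + s ^ 2 = 1) (k : ℕ) :
    (rotationTrace c s k).eval 1 = k + 1 := by
  simp [rotationTrace, eval_finsetSum, eval_one_rotationDiag h]

lemma rotationTrace_zero (c s : ℝ) : rotationTrace c s 0 = 1 := by
  simp [rotationTrace, rotationDiag, diagCoeff_zero_left]

lemma rotationTrace_one (c s : ℝ) :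
    rotationTrace c s 1 = C (s ^ 2) + C (2 * c ^ 2) * X + C (s ^ 2) * X ^ 2 := by
  rw [rotationTrace, Nat.sum_antidiagonal_succ]
  simp only [rotationDiag, zero_add, Nat.antidiagonal_zero, sum_singleton, diagCoeff_zero_left,
    diagCoeff_succ_zero, map_mul, C_ofNat]
  ring

lemma rotationTrace_add_two {c s : ℝ} (h : c ^ 2 + s ^ 2 = 1) (k : ℕ) :
    rotationTrace c s (k + 2)
      = (C (s ^ 2) + C (2 * c ^ 2) * X + C (s ^ 2) * X ^ 2) * rotationTrace c s (k + 1)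
        - X ^ 2 * rotationTrace c s k := by
  have hC : (C c : ℝ[X]) ^ 2 = 1 - C s ^ 2 := by
    rw [← C_pow, ← C_pow, ← C_1, ← C_sub]; congr 1; linarith
  have hs := sum_antidiagonal_recurrence (fun m n => X ^ n * rotationDiag c s m n)
    (C (c ^ 2) * X + C (s ^ 2)) (X * (C (s ^ 2) * X + C (c ^ 2))) (X ^ 2)
    (fun n => by simp only [rotationDiag, diagCoeff_zero_left]; ring)
    (fun m => by simp only [rotationDiag, diagCoeff_succ_zero]; ring)
    (fun m n => by
      simp only [rotationDiag]
      rw [diagCoeff_succ_succ]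
      have hdet : (C (c ^ 2) * X + C (s ^ 2)) * (C (s ^ 2) * X + C (c ^ 2))
          - C (c * s) * (X - 1) * (C (c * s) * (X - 1)) = (X : ℝ[X]) := by
        simp only [map_pow, map_mul]
        linear_combination (X * (C c ^ 2 + 1 + C s ^ 2)) * hC
      rw [hdet]
      ring) k
  rw [rotationTrace, hs]
  simp only [rotationTrace, map_mul, C_ofNat]
  ring

end Rotation

section Scheme

/-- Translation by `j` on real sequences indexed by `ℤ`. -/
def translation (j : ℤ) : Module.End ℝ (ℤ → ℝ) := LinearMap.funLeft ℝ ℝ (· + j)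

@[simp] lemma translation_apply (j : ℤ) (f : ℤ → ℝ) (i : ℤ) : translation j f i = f (i + j) := rfl

lemma translation_one_pow_apply (k : ℕ) (f : ℤ → ℝ) (i : ℤ) :
    (translation 1 ^ k) f i = f (i + k) := by
  induction k generalizing i with
  | zero => simp
  | succ k ih => rw [pow_succ', Module.End.mul_apply, translation_apply, ih]; congr 1; push_cast; ring

lemma abs_aeval_translation_le {P : ℝ[X]} (hP : ∀ l, 0 ≤ P.coeff l) {f : ℤ → ℝ} {B : ℝ}
    (hf : ∀ i, |f i| ≤ B) (i : ℤ) :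
    |aeval (translation 1) P f i| ≤ P.eval 1 * B := by
  rw [aeval_eq_sum_range, LinearMap.sum_apply, Finset.sum_apply, eval_eq_sum_range, sum_mul]
  refine (abs_sum_le_sum_abs _ _).trans (sum_le_sum fun l _ => ?_)
  rw [LinearMap.smul_apply, Pi.smul_apply, translation_one_pow_apply, smul_eq_mul, abs_mul,
    abs_of_nonneg (hP l), one_pow, mul_one]
  exact mul_le_mul_of_nonneg_left (hf _) (hP l)

/-- The operator `f ↦ 2 f + a (f (· + 1) - 2 f + f (· - 1))` of the finite difference scheme. -/
noncomputable def schemeStep (a : ℝ) : Module.End ℝ (ℤ → ℝ) :=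
  (2 * (1 - a)) • 1 + a • (translation 1 + translation (-1))

lemma schemeStep_apply (a : ℝ) (f : ℤ → ℝ) (i : ℤ) :
    schemeStep a f i = 2 * f i + a * (f (i + 1) - 2 * f i + f (i - 1)) := by
  simp [schemeStep, ← sub_eq_add_neg]; ring

lemma abs_schemeStep_le {a : ℝ} (ha0 : 0 ≤ a) (ha1 : a ≤ 1) {f : ℤ → ℝ} {B : ℝ}
    (hf : ∀ i, |f i| ≤ B) (i : ℤ) : |schemeStep a f i| ≤ 2 * B := by
  have h0 := abs_le.1 (hf i)
  have h1 := abs_le.1 (hf (i + 1))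
  have h2 := abs_le.1 (hf (i - 1))
  rw [schemeStep_apply, abs_le]
  constructor <;> nlinarith

/-- The fundamental solution of the finite difference scheme after `k` steps. -/
noncomputable def schemePropagator (a : ℝ) (k : ℕ) : Module.End ℝ (ℤ → ℝ) :=
  translation (-k) * aeval (translation 1) (rotationTrace √(1 - a) √a k)

lemma schemePropagator_zero (a : ℝ) : schemePropagator a 0 = 1 := by
  ext f i
  simp [schemePropagator, rotationTrace_zero]

lemma aeval_stepPolynomial_apply (a b : ℝ) (f : ℤ → ℝ) (i : ℤ) :
    aeval (translation 1) (C a + C b * X + C a * X ^ 2 : ℝ[X]) f i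
      = a * f i + b * f (i + 1) + a * f (i + 2) := by
  simp [translation_one_pow_apply, Module.algebraMap_end_apply]

lemma schemePropagator_one {a : ℝ} (ha0 : 0 ≤ a) (ha1 : a ≤ 1) :
    schemePropagator a 1 = schemeStep a := by
  refine LinearMap.ext fun f => funext fun i => ?_
  rw [schemePropagator, rotationTrace_one, Module.End.mul_apply, translation_apply,
    aeval_stepPolynomial_apply, Real.sq_sqrt ha0, Real.sq_sqrt (sub_nonneg.2 ha1),
    schemeStep_apply]
  rw [show i + -((1 : ℕ) : ℤ) = i - 1 by simp [sub_eq_add_neg], sub_add_cancel,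
    show i - 1 + 2 = i + 1 by ring]
  ring

lemma schemePropagator_add_two {a : ℝ} (ha0 : 0 ≤ a) (ha1 : a ≤ 1) (k : ℕ) :
    schemePropagator a (k + 2)
      = schemeStep a * schemePropagator a (k + 1) - schemePropagator a k := by
  have hcs : √(1 - a) ^ 2 + √a ^ 2 = 1 := by
    rw [Real.sq_sqrt ha0, Real.sq_sqrt (sub_nonneg.2 ha1)]; ring
  refine LinearMap.ext fun f => funext fun i => ?_
  rw [LinearMap.sub_apply, Pi.sub_apply, Module.End.mul_apply, schemeStep_apply]
  simp only [schemePropagator, Module.End.mul_apply, translation_apply]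
  rw [rotationTrace_add_two hcs, map_sub, map_mul (aeval _), map_mul (aeval _), LinearMap.sub_apply, Pi.sub_apply,
    Module.End.mul_apply, Module.End.mul_apply, aeval_stepPolynomial_apply, map_pow, aeval_X,
    translation_one_pow_apply, Real.sq_sqrt ha0, Real.sq_sqrt (sub_nonneg.2 ha1)]
  push_cast
  ring_nf

lemma abs_schemePropagator_le {a : ℝ} (ha0 : 0 ≤ a) (ha1 : a ≤ 1) (k : ℕ) {f : ℤ → ℝ} {B : ℝ}
    (hf : ∀ i, |f i| ≤ B) (i : ℤ) : |schemePropagator a k f i| ≤ (k + 1) * B := by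
  have hcs : √(1 - a) ^ 2 + √a ^ 2 = 1 := by
    rw [Real.sq_sqrt ha0, Real.sq_sqrt (sub_nonneg.2 ha1)]; ring
  rw [← eval_one_rotationTrace hcs k]
  exact abs_aeval_translation_le (coeff_rotationTrace_nonneg _ _ k) hf _

end Scheme

/-- Discrete Duhamel formula for a second-order linear recurrence. -/
lemma eq_sum_of_second_order_recurrence {A M : Type*} [Ring A] [AddCommGroup M] [Module A M]
    {c : A} {L : ℕ → A} (hL0 : L 0 = 1) (hL1 : L 1 = c)
    (hL : ∀ k, L (k + 2) = c * L (k + 1) - L k)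
    {u g : ℕ → M} (h0 : u 0 = g 0) (h1 : u 1 = c • g 0 + g 1)
    (hu : ∀ k, u (k + 2) = c • u (k + 1) - u k + g (k + 2)) (k : ℕ) :
    u k = ∑ lj ∈ antidiagonal k, L lj.1 • g lj.2 := by
  induction k using Nat.twoStepInduction with
  | zero => simp [hL0, h0]
  | one => simp [Nat.sum_antidiagonal_succ, hL0, hL1, h1, add_comm]
  | more k ih0 ih1 =>
    rw [hu, ih1, ih0, Nat.sum_antidiagonal_succ, Nat.sum_antidiagonal_succ,
      Nat.sum_antidiagonal_succ]
    simp only [zero_add, hL0, hL1, one_smul, hL, sub_smul, mul_smul, sum_sub_distrib, smul_add,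
      smul_sum]
    abel


/-!
STATEMENT 16: uniform bound on the accumulated error of the finite
difference scheme for the 1D wave equation:
`|Δ_i^k| ≤ (k+1)(k+2)·δ̄/2` for all `i` and `k`.
-/

theorem wave_error_uniform_bound
    (n : ℕ) (hn : 1 ≤ n) (a : ℝ) (ha0 : 0 < a) (ha1 : a ≤ 1)
    (Δ δ : ℤ → ℕ → ℝ)
    (hΔper : ∀ (i : ℤ) (k : ℕ), Δ (i + 2 * (n : ℤ)) k = Δ i k)
    (hδper : ∀ (i : ℤ) (k : ℕ), δ (i + 2 * (n : ℤ)) k = δ i k)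
    (h0 : ∀ i : ℤ, Δ i 0 = δ i 0)
    (h1 : ∀ i : ℤ, Δ i 1 = δ i 1)
    (hrec : ∀ (i : ℤ) (k : ℕ), 1 ≤ k →
      Δ i (k + 1) = 2 * Δ i k - Δ i (k - 1)
        + a * (Δ (i + 1) k - 2 * Δ i k + Δ (i - 1) k) + δ i (k + 1))
    (d0 d1 d : ℝ) (hd0 : 0 ≤ d0) (hd1 : 0 ≤ d1) (hd : 0 ≤ d)
    (hc1 : d0 ≤ d) (hc2 : d1 + 2 * d0 ≤ d)
    (hb0 : ∀ i : ℤ, |δ i 0| ≤ d0)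
    (hb1 : ∀ i : ℤ, |δ i 1| ≤ d1)
    (hbk : ∀ (i : ℤ) (k : ℕ), 2 ≤ k → |δ i k| ≤ d) :
    ∀ (i : ℤ) (k : ℕ), |Δ i k| ≤ ((k : ℝ) + 1) * ((k : ℝ) + 2) * d / 2 := by
  intro i k
  set g : ℕ → ℤ → ℝ := fun k => match k with
    | 0 => fun i => δ i 0
    | 1 => fun i => δ i 1 - schemeStep a (fun i => δ i 0) i
    | k + 2 => fun i => δ i (k + 2) with hg
  have hbound : ∀ k i, |g k i| ≤ d := by
    intro k i
    match k with
    | 0 => exact (hb0 i).trans hc1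
    | 1 =>
      have hstep := abs_schemeStep_le ha0.le ha1 hb0 i
      exact (abs_sub _ _).trans ((add_le_add (hb1 i) hstep).trans hc2)
    | k + 2 => exact hbk i (k + 2) (Nat.le_add_left 2 k)
  have hsum := eq_sum_of_second_order_recurrence (schemePropagator_zero a)
    (schemePropagator_one ha0.le ha1) (schemePropagator_add_two ha0.le ha1)
    (u := fun k i => Δ i k) (g := g) (funext h0)
    (funext fun i => by simp [hg, h1])
    (fun k => funext fun i => by
      have hi := hrec i (k + 1) (Nat.le_add_left 1 k)
      simp only [Module.End.smul_def, Pi.add_apply, Pi.sub_apply, schemeStep_apply, hg]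
      rw [hi, Nat.add_sub_cancel]
      ring) k
  have hik := congrFun hsum i
  simp only [Finset.sum_apply, Module.End.smul_def] at hik
  have hgauss : ∀ k : ℕ, ∑ lj ∈ antidiagonal k, ((lj.1 : ℝ) + 1) * d
      = ((k : ℝ) + 1) * ((k : ℝ) + 2) * d / 2 := by
    intro k
    induction k with
    | zero => simp
    | succ k ih =>
      rw [Nat.sum_antidiagonal_succ', ih]
      push_cast
      ring
  rw [hik, ← hgauss]
  exact (abs_sum_le_sum_abs _ _).trans
    (sum_le_sum fun lj _ => abs_schemePropagator_le ha0.le ha1 lj.1 (hbound lj.2) i)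
end
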